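/- arXiv:1604.00868 — 3 statements merged into one kernel-verified Lean document; each statement's English description precedes it below -/
import Mathlib

section
/- Let N ≥ 4 be even and h_p > 0. Define the symmetric N×N matrix Ψ₁ by: Ψ₁(1,1) = 1 + 2/h_p; Ψ₁(i,i) = 2 for i = 2,…,N−2; Ψ₁(N−1,N−1) = Ψ₁(N,N) = 1; Ψ₁(i,i+2) = Ψ₁(i+2,i) = −1 for i = 1,…,N−2; and all other entries zero. Then with γ = min{1, 1/h_p}, the smallest eigenvalue of Ψ₁ satisfies λ_min(Ψ₁) ≥ γ/N²; equivalently, xᵀΨ₁x ≥ (γ/N²)|x|₂² for every x ∈ ℝ^N. -/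
open Matrix MeasureTheory Real

/-- The N×N matrix with 1 on the diagonal and -1 on the first superdiagonal. -/
noncomputable def Bmat (N : ℕ) : Matrix (Fin N) (Fin N) ℝ :=
  Matrix.of fun i j => if j = i then 1 else if (j : ℕ) = (i : ℕ) + 1 then -1 else 0

/-- Entrywise absolute value of `Bmat N`. -/
noncomputable def absB (N : ℕ) : Matrix (Fin N) (Fin N) ℝ :=
  Matrix.of fun i j => |Bmat N i j|

/-- Euclidean norm of a vector in ℝ^N. -/
noncomputable def norm2 {N : ℕ} (x : Fin N → ℝ) : ℝ := Real.sqrt (x ⬝ᵥ x)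

/-- The Hamiltonian H(p, Δ) = ½(p − v₀M𝟙)ᵀ M⁻¹ (p − v₀M𝟙) + ½ Δᵀ A Δ. -/
noncomputable def Ham {N : ℕ} (v0 : ℝ) (m a : Fin N → ℝ) (p Δ : Fin N → ℝ) : ℝ :=
  (1/2) * ((p - v0 • (Matrix.diagonal m *ᵥ fun _ => 1)) ⬝ᵥ
      (Matrix.diagonal (fun i => (m i)⁻¹) *ᵥ (p - v0 • (Matrix.diagonal m *ᵥ fun _ => 1)))) +
  (1/2) * (Δ ⬝ᵥ (Matrix.diagonal a *ᵥ Δ))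

/-- The matrix Ψ₁ of Statement 8 (0-indexed): Ψ₁(0,0) = 1 + 2/h_p, Ψ₁(i,i) = 2 for
1 ≤ i ≤ N−3, Ψ₁(N−2,N−2) = Ψ₁(N−1,N−1) = 1, Ψ₁(i,i±2) = −1, all other entries 0. -/
noncomputable def Psi1 (N : ℕ) (hp : ℝ) : Matrix (Fin N) (Fin N) ℝ :=
  Matrix.of fun i j =>
    if i = j then
      (if (i : ℕ) = 0 then 1 + 2 / hp else if (i : ℕ) ≥ N - 2 then 1 else 2)
    else if (j : ℕ) = (i : ℕ) + 2 ∨ (i : ℕ) = (j : ℕ) + 2 then -1 else 0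

/-- Discrete Poincaré-type estimate with step two: `f i ^ 2` is controlled by the two initial values
and the squared increments `f (j + 2) - f j`. -/
theorem sq_le_mul_sum_sq_sub_two (f : ℕ → ℝ) (i : ℕ) : ∀ m : ℕ, i ≤ m + 1 →
    f i ^ 2 ≤ ((i : ℝ) + 1) *
      (f 0 ^ 2 + f 1 ^ 2 + ∑ j ∈ Finset.range m, (f j - f (j + 2)) ^ 2) := by
  induction i using Nat.twoStepInduction with
  | zero =>
    intro m _
    have := Finset.sum_nonneg fun j (_ : j ∈ Finset.range m) => sq_nonneg (f j - f (j + 2))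
    push_cast
    nlinarith [sq_nonneg (f 1)]
  | one =>
    intro m _
    have := Finset.sum_nonneg fun j (_ : j ∈ Finset.range m) => sq_nonneg (f j - f (j + 2))
    push_cast
    nlinarith [sq_nonneg (f 1), sq_nonneg (f 0)]
  | more i ih _ =>
    intro m hm
    have h := ih i (by omega)
    have hmono : ∑ j ∈ Finset.range (i + 1), (f j - f (j + 2)) ^ 2 ≤
        ∑ j ∈ Finset.range m, (f j - f (j + 2)) ^ 2 :=
      Finset.sum_le_sum_of_subset_of_nonneg (Finset.range_mono (by omega))
        fun j _ _ => sq_nonneg _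
    rw [Finset.sum_range_succ] at hmono
    set S := ∑ j ∈ Finset.range i, (f j - f (j + 2)) ^ 2
    set T := ∑ j ∈ Finset.range m, (f j - f (j + 2)) ^ 2
    set E := f 0 ^ 2 + f 1 ^ 2 + S with hE
    have hk : (0 : ℝ) < (i : ℝ) + 1 := by positivity
    have hstep : f (i + 2) ^ 2 ≤ ((i : ℝ) + 2) * (E + (f i - f (i + 2)) ^ 2) := by
      have hyoung : ((i : ℝ) + 1) * f (i + 2) ^ 2 ≤
          ((i : ℝ) + 2) * f i ^ 2 + ((i : ℝ) + 1) * ((i : ℝ) + 2) * (f i - f (i + 2)) ^ 2 := by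
        nlinarith [sq_nonneg (f i + ((i : ℝ) + 1) * (f i - f (i + 2)))]
      have h' := mul_le_mul_of_nonneg_left h (by positivity : (0 : ℝ) ≤ (i : ℝ) + 2)
      refine le_of_mul_le_mul_left ?_ hk
      linarith
    have hE0 : E + (f i - f (i + 2)) ^ 2 ≤ f 0 ^ 2 + f 1 ^ 2 + T := by linarith
    have hT : 0 ≤ f 0 ^ 2 + f 1 ^ 2 + T := by positivity
    push_cast
    have := mul_le_mul_of_nonneg_left hE0 (by positivity : (0 : ℝ) ≤ (i : ℝ) + 2)
    linarith

/-- The quadratic form of `Psi1` as a sum of squares. -/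
theorem dotProduct_Psi1_mulVec (M : ℕ) (hM : 2 ≤ M) (hp : ℝ) (f : ℕ → ℝ) :
    (fun i : Fin (M + 2) => f i) ⬝ᵥ (Psi1 (M + 2) hp *ᵥ fun i => f i) =
      2 / hp * f 0 ^ 2 + f 1 ^ 2 + ∑ j ∈ Finset.range M, (f j - f (j + 2)) ^ 2 := by
  have hrow : ∀ i : Fin (M + 2), (Psi1 (M + 2) hp *ᵥ fun i => f i) i =
      (if (i : ℕ) < M then f i - f (i + 2) else 0) +
      (if 2 ≤ (i : ℕ) then f i - f (i - 2) else 0) +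
      ((if (i : ℕ) = 0 then 2 / hp * f 0 else 0) + (if (i : ℕ) = 1 then f 1 else 0)) := by
    intro i
    have hentry : ∀ j : Fin (M + 2), Psi1 (M + 2) hp i j * f j =
        (if (j : ℕ) = i then (if (i : ℕ) = 0 then 1 + 2 / hp else if M ≤ (i : ℕ) then 1 else 2)
          * f i else 0) - (if (j : ℕ) = i + 2 then f (i + 2) else 0) -
        (if 2 ≤ (i : ℕ) then (if (j : ℕ) = i - 2 then f (i - 2) else 0) else 0) := by
      intro j
      have hi := i.2
      simp only [Psi1, Matrix.of_apply, Fin.ext_iff, Nat.add_sub_cancel, ge_iff_le]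
      by_cases h1 : (j : ℕ) = i
      · have h2 : ¬ (2 ≤ (i : ℕ) ∧ (i : ℕ) = i - 2) := by omega
        simp [h1, ← ite_and, h2]
      · by_cases h2 : (j : ℕ) = i + 2
        · have h3 : ¬ (2 ≤ (i : ℕ) ∧ (i : ℕ) + 2 = i - 2) := by omega
          simp [h2, ← ite_and, h3]
        · by_cases h3 : (i : ℕ) = j + 2
          · have h4 : (j : ℕ) ≠ j + 2 + 2 := by omega
            simp [h3, h4]
          · have h4 : ¬ (2 ≤ (i : ℕ) ∧ (j : ℕ) = i - 2) := by omega
            simp [h1, h2, h3, Ne.symm h1, ← ite_and, h4]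
    simp only [Matrix.mulVec, dotProduct]
    rw [Finset.sum_congr rfl fun j _ => hentry j]
    have hi := i.2
    generalize (i : ℕ) = k at hi
    rw [Fin.sum_univ_eq_sum_range (fun j => (if j = k then
      (if k = 0 then 1 + 2 / hp else if M ≤ k then 1 else 2) * f k else 0) -
      (if j = k + 2 then f (k + 2) else 0) -
      (if 2 ≤ k then (if j = k - 2 then f (k - 2) else 0) else 0)) (M + 2)]
    simp only [Finset.sum_sub_distrib]
    by_cases h2 : 2 ≤ k
    · have h3 : k - 2 < M + 2 := by omega
      have h4 : k ≠ 0 := by omega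
      have h5 : k ≠ 1 := by omega
      by_cases h6 : k < M
      · simp [h2, h3, h4, h5, h6, hi, not_le.mpr h6]; ring
      · simp [h2, h3, h4, h5, h6, hi, not_lt.mp h6]
    · have h6 : k < M := by omega
      obtain rfl | rfl : k = 0 ∨ k = 1 := by omega
      · simp [h6]; ring
      · have h7 : 3 < M + 2 := by omega
        simp [h6, h7, not_le.mpr h6]; ring
  simp only [dotProduct]
  rw [Finset.sum_congr rfl fun i _ => by rw [hrow i],
    Fin.sum_univ_eq_sum_range (fun i => f i * (
      (if i < M then f i - f (i + 2) else 0) +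
      (if 2 ≤ i then f i - f (i - 2) else 0) +
      ((if i = 0 then 2 / hp * f 0 else 0) + (if i = 1 then f 1 else 0)))) (M + 2)]
  simp only [mul_add, Finset.sum_add_distrib]
  have hA : ∑ i ∈ Finset.range (M + 2), f i * (if i < M then f i - f (i + 2) else 0) =
      ∑ i ∈ Finset.range M, f i * (f i - f (i + 2)) := by
    rw [Finset.sum_range_succ, Finset.sum_range_succ]
    simp only [lt_irrefl, if_false, mul_zero, add_zero, not_lt.mpr (Nat.le_succ M)]
    exact Finset.sum_congr rfl fun i hi => by rw [if_pos (Finset.mem_range.mp hi)]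
  have hB : ∑ i ∈ Finset.range (M + 2), f i * (if 2 ≤ i then f i - f (i - 2) else 0) =
      ∑ i ∈ Finset.range M, f (i + 2) * (f (i + 2) - f i) := by
    rw [Finset.sum_range_succ', Finset.sum_range_succ']
    simp
  have hS : ∑ j ∈ Finset.range M, (f j - f (j + 2)) ^ 2 =
      ∑ i ∈ Finset.range M, f i * (f i - f (i + 2)) +
      ∑ i ∈ Finset.range M, f (i + 2) * (f (i + 2) - f i) := by
    rw [← Finset.sum_add_distrib]
    exact Finset.sum_congr rfl fun i _ => by ring
  rw [hA, hB, hS]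
  simp
  ring

/-- λ_min(Ψ₁) ≥ γ/N² with γ = min{1, 1/h_p}, stated as a quadratic-form bound. -/
theorem stmt_8 (N : ℕ) (hN : 4 ≤ N) (hNeven : Even N) (hp : ℝ) (hhp : 0 < hp) :
    ∀ x : Fin N → ℝ,
      min 1 (1 / hp) / (N : ℝ) ^ 2 * (x ⬝ᵥ x) ≤ x ⬝ᵥ (Psi1 N hp *ᵥ x) := by
  obtain ⟨M, rfl⟩ : ∃ M, N = M + 2 := ⟨N - 2, by omega⟩
  intro x
  obtain ⟨f, rfl⟩ : ∃ f : ℕ → ℝ, x = fun i : Fin (M + 2) => f i :=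
    ⟨fun n => if h : n < M + 2 then x ⟨n, h⟩ else 0, by ext i; simp⟩
  rw [dotProduct_Psi1_mulVec M (by omega) hp f]
  set T := ∑ j ∈ Finset.range M, (f j - f (j + 2)) ^ 2 with hT
  have hT0 : 0 ≤ T := Finset.sum_nonneg fun j _ => sq_nonneg _
  set E := f 0 ^ 2 + f 1 ^ 2 + T with hE
  have hE0 : 0 ≤ E := by positivity
  have hsum : (fun i : Fin (M + 2) => f i) ⬝ᵥ (fun i : Fin (M + 2) => f i) ≤
      ((M + 2 : ℕ) : ℝ) ^ 2 * E := by
    have hterm : ∀ i ∈ (Finset.univ : Finset (Fin (M + 2))),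
        f i * f i ≤ ((M + 2 : ℕ) : ℝ) * E := by
      intro i _
      have h := sq_le_mul_sum_sq_sub_two f i M (by omega)
      have hi : ((i : ℕ) : ℝ) + 1 ≤ ((M + 2 : ℕ) : ℝ) := by exact_mod_cast i.2
      rw [← sq]
      exact h.trans (mul_le_mul_of_nonneg_right hi hE0)
    refine (Finset.sum_le_card_nsmul _ _ _ hterm).trans_eq ?_
    simp only [Finset.card_univ, Fintype.card_fin, nsmul_eq_mul]
    ring
  have hinv : 0 < 1 / hp := by positivity
  set γ := min 1 (1 / hp) with hγ
  have hγ0 : 0 ≤ γ := le_min zero_le_one hinv.le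
  have hγ1 : γ ≤ 1 := min_le_left _ _
  have hγ2 : γ ≤ 2 / hp := (min_le_right _ _).trans (by gcongr; norm_num)
  have hN0 : (0 : ℝ) < ((M + 2 : ℕ) : ℝ) ^ 2 := by positivity
  calc γ / ((M + 2 : ℕ) : ℝ) ^ 2 * _ ≤ γ / ((M + 2 : ℕ) : ℝ) ^ 2 * (((M + 2 : ℕ) : ℝ) ^ 2 * E) :=
        mul_le_mul_of_nonneg_left hsum (by positivity)
    _ = γ * E := by field_simp
    _ ≤ 2 / hp * f 0 ^ 2 + f 1 ^ 2 + T := by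
        nlinarith [mul_le_mul_of_nonneg_right hγ2 (sq_nonneg (f 0)),
          mul_le_mul_of_nonneg_right hγ1 (sq_nonneg (f 1)), mul_le_mul_of_nonneg_right hγ1 hT0]
end

section
/- Let 0 ≤ h_d < 1 and let E = diag(1, q, q², …, q^{N−1}) with q = (1−h_d)/(1+h_d). Then the matrix identity (1/(1+h_d))·(B + h_d⟨B⟩)·E⁻¹ = E⁻¹·B holds. -/
open Matrix MeasureTheory Real

/-- matrix identity (1/(1+h_d))·(B + h_d⟨B⟩)·E⁻¹ = E⁻¹·B, where
E = diag(1, q, …, q^{N−1}) with q = (1−h_d)/(1+h_d). -/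
theorem stmt_12 (N : ℕ) (hN : 1 ≤ N) (hd : ℝ) (hhd0 : 0 ≤ hd) (hhd1 : hd < 1) :
    (1 / (1 + hd)) •
        ((Bmat N + hd • absB N) *
          (Matrix.diagonal (fun i : Fin N => ((1 - hd) / (1 + hd)) ^ (i : ℕ)))⁻¹)
      = (Matrix.diagonal (fun i : Fin N => ((1 - hd) / (1 + hd)) ^ (i : ℕ)))⁻¹ * Bmat N := by
  have h1 : 1 + hd ≠ 0 := by linarith
  have h2 : 1 - hd ≠ 0 := by linarith
  have hq : (1 - hd) / (1 + hd) ≠ 0 := div_ne_zero h2 h1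
  have hinv : (Matrix.diagonal (fun i : Fin N => ((1 - hd) / (1 + hd)) ^ (i : ℕ)))⁻¹
      = Matrix.diagonal (fun i : Fin N => (((1 - hd) / (1 + hd)) ^ (i : ℕ))⁻¹) := by
    apply Matrix.inv_eq_right_inv
    rw [Matrix.diagonal_mul_diagonal, ← Matrix.diagonal_one]
    congr 1
    funext i
    exact mul_inv_cancel₀ (pow_ne_zero _ hq)
  rw [hinv]
  ext i j
  simp only [Matrix.smul_apply, Matrix.mul_diagonal, Matrix.diagonal_mul, Matrix.add_apply,
    smul_eq_mul, absB, Bmat, Matrix.of_apply]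
  split_ifs with hij hsucc
  · subst hij
    rw [abs_one]
    field_simp
  · rw [hsucc, abs_neg, abs_one, pow_succ]
    field_simp
    ring
  · simp
end

section
/- Let h_p = 0 (symmetric coupling), let R = diag(r₁,…,r_N), A = diag(a₁,…,a_N), M = diag(m₁,…,m_N) be diagonal with a_i > 0, m_i > 0 and r_i ≥ r̲ > 0 for all i. Let d : [0,∞) → ℝ^N be measurable with ∫₀^∞ |d(s)|₂² ds < ∞ and let (p, Δ) : [0,∞) → ℝ^N × ℝ^N be differentiable and satisfy ṗ(t) = −BRBᵀ(M⁻¹p(t) − v₀𝟙) + BAΔ(t) + d(t), Δ̇(t) = −Bᵀ(M⁻¹p(t) − v₀𝟙) for all t ≥ 0. Then for every t ≥ 0, H(p(t), Δ(t)) ≤ H(p(0), Δ(0)) + (2N²/r̲)·∫₀^∞ |d(s)|₂² ds; that is, the effect of the disturbance on the energy scales at most quadratically in the string length N. -/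
open Matrix MeasureTheory Real

theorem Bmat_transpose_mulVec_zero {N : ℕ} (y : Fin N → ℝ) (h : 0 < N) :
    ((Bmat N)ᵀ *ᵥ y) ⟨0, h⟩ = y ⟨0, h⟩ := by
  simp [mulVec, dotProduct, Bmat]

theorem Bmat_transpose_mulVec_succ {N : ℕ} (y : Fin N → ℝ) (k : ℕ) (h : k + 1 < N) :
    ((Bmat N)ᵀ *ᵥ y) ⟨k + 1, h⟩ = y ⟨k + 1, h⟩ - y ⟨k, by omega⟩ := by
  have hterm : ∀ i : Fin N, (Bmat N)ᵀ ⟨k + 1, h⟩ i * y i =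
      (if (⟨k + 1, h⟩ : Fin N) = i then y i else 0) -
        (if (⟨k, by omega⟩ : Fin N) = i then y i else 0) := by
    intro i
    simp only [Bmat, transpose_apply, of_apply, Fin.ext_iff]
    split_ifs <;> first | omega | simp
  simp only [mulVec, dotProduct, hterm, Finset.sum_sub_distrib, Finset.sum_ite_eq,
    Finset.mem_univ, if_true]

/-- Each coordinate of `y` is a partial sum of the coordinates of `Bᵀ y`. -/
theorem eq_sum_Bmat_transpose_mulVec {N : ℕ} (y : Fin N → ℝ) (k : ℕ) (h : k < N) :
    y ⟨k, h⟩ = ∑ j ∈ Finset.range (k + 1),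
      if hj : j < N then ((Bmat N)ᵀ *ᵥ y) ⟨j, hj⟩ else 0 := by
  induction k with
  | zero => simp [h, Bmat_transpose_mulVec_zero]
  | succ k ih =>
    rw [Finset.sum_range_succ, ← ih (by omega), dif_pos h, Bmat_transpose_mulVec_succ]
    ring

theorem dotProduct_self_le_Bmat_transpose_mulVec {N : ℕ} (y : Fin N → ℝ) :
    y ⬝ᵥ y ≤ (N : ℝ) ^ 2 * (((Bmat N)ᵀ *ᵥ y) ⬝ᵥ ((Bmat N)ᵀ *ᵥ y)) := by
  set z := (Bmat N)ᵀ *ᵥ y with hz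
  have hcoord : ∀ i : Fin N, y i * y i ≤ N * (z ⬝ᵥ z) := by
    rintro ⟨k, hk⟩
    have hsum : z ⬝ᵥ z = ∑ j ∈ Finset.range N, (if hj : j < N then z ⟨j, hj⟩ else 0) ^ 2 := by
      rw [dotProduct, Finset.sum_fin_eq_sum_range]
      refine Finset.sum_congr rfl fun j _ => ?_
      split_ifs <;> ring
    rw [hsum, ← sq, eq_sum_Bmat_transpose_mulVec y k hk, ← hz]
    refine sq_sum_le_card_mul_sum_sq.trans ?_
    rw [Finset.card_range]
    gcongr <;> omega
  calc y ⬝ᵥ y ≤ ∑ _i : Fin N, N * (z ⬝ᵥ z) := Finset.sum_le_sum fun i _ => hcoord i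
    _ = (N : ℝ) ^ 2 * (z ⬝ᵥ z) := by simp; ring

/-- The power supplied by the disturbance, minus the dissipation, is bounded by the squared
norm of the disturbance. -/
theorem dotProduct_sub_dissipation_le {N : ℕ} (hN : 1 ≤ N) {rlow : ℝ} (hrlow : 0 < rlow)
    {r : Fin N → ℝ} (hr : ∀ i, rlow ≤ r i) (y d : Fin N → ℝ) :
    y ⬝ᵥ d - ((Bmat N)ᵀ *ᵥ y) ⬝ᵥ (diagonal r *ᵥ ((Bmat N)ᵀ *ᵥ y)) ≤
      2 * (N : ℝ) ^ 2 / rlow * (d ⬝ᵥ d) := by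
  have hy := dotProduct_self_le_Bmat_transpose_mulVec y
  set z := (Bmat N)ᵀ *ᵥ y
  have hN2 : (0 : ℝ) < (N : ℝ) ^ 2 := by positivity
  have hdiss : rlow * (z ⬝ᵥ z) ≤ z ⬝ᵥ (diagonal r *ᵥ z) := by
    simp only [dotProduct, mulVec_diagonal, Finset.mul_sum]
    refine Finset.sum_le_sum fun i _ => ?_
    nlinarith [mul_le_mul_of_nonneg_right (hr i) (mul_self_nonneg (z i))]
  have hyz : rlow / (N : ℝ) ^ 2 * (y ⬝ᵥ y) ≤ rlow * (z ⬝ᵥ z) := by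
    rw [div_mul_eq_mul_div, div_le_iff₀ hN2]
    nlinarith
  have hyoung : y ⬝ᵥ d ≤ rlow / (N : ℝ) ^ 2 * (y ⬝ᵥ y) + 2 * (N : ℝ) ^ 2 / rlow * (d ⬝ᵥ d) := by
    simp only [dotProduct, Finset.mul_sum, ← Finset.sum_add_distrib]
    refine Finset.sum_le_sum fun i _ => ?_
    rw [← sub_nonneg]
    have hsq : rlow / (N : ℝ) ^ 2 * (y i * y i) + 2 * (N : ℝ) ^ 2 / rlow * (d i * d i) - y i * d i =
        ((rlow * y i - (N : ℝ) ^ 2 * d i / 2) ^ 2 + 7 / 4 * ((N : ℝ) ^ 2 * d i) ^ 2) /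
          ((N : ℝ) ^ 2 * rlow) := by
      field_simp
      ring
    rw [hsq]
    positivity
  linarith

theorem hasDerivAt_Ham {N : ℕ} (v0 : ℝ) (a : Fin N → ℝ) {m : Fin N → ℝ} (hm : ∀ i, 0 < m i)
    {p Δ : ℝ → Fin N → ℝ} {p' Δ' : Fin N → ℝ} {t : ℝ}
    (hp : HasDerivAt p p' t) (hΔ : HasDerivAt Δ Δ' t) :
    HasDerivAt (fun s => Ham v0 m a (p s) (Δ s))
      ((diagonal (fun i => (m i)⁻¹) *ᵥ p t - v0 • (fun _ : Fin N => (1 : ℝ))) ⬝ᵥ p' +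
        (diagonal a *ᵥ Δ t) ⬝ᵥ Δ') t := by
  have hH : (fun s => Ham v0 m a (p s) (Δ s)) = fun s =>
      ∑ i, ((1 / 2) * (m i)⁻¹ * (p s i - v0 * m i) ^ 2 + (1 / 2) * a i * (Δ s i) ^ 2) := by
    funext s
    simp only [Ham, dotProduct, mulVec_diagonal, Finset.mul_sum, ← Finset.sum_add_distrib,
      Pi.sub_apply, Pi.smul_apply, smul_eq_mul]
    refine Finset.sum_congr rfl fun i _ => ?_
    ring
  rw [hH]
  rw [hasDerivAt_pi] at hp hΔ
  simp only [dotProduct, ← Finset.sum_add_distrib]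
  refine HasDerivAt.fun_sum fun i _ => ?_
  refine (((((hp i).sub_const (v0 * m i)).pow 2).const_mul ((1 / 2) * (m i)⁻¹)).add
    (((hΔ i).pow 2).const_mul ((1 / 2) * a i))).congr_deriv ?_
  have := (hm i).ne'
  simp only [mulVec_diagonal, Pi.sub_apply, Pi.smul_apply, smul_eq_mul]
  field_simp
  ring

/-- The power balance of the symmetric string. -/
theorem power_balance {N : ℕ} (r a y Δ d : Fin N → ℝ) :
    y ⬝ᵥ (-((Bmat N * diagonal r * (Bmat N)ᵀ) *ᵥ y) + (Bmat N * diagonal a) *ᵥ Δ + d) +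
        (diagonal a *ᵥ Δ) ⬝ᵥ (-((Bmat N)ᵀ *ᵥ y)) =
      y ⬝ᵥ d - ((Bmat N)ᵀ *ᵥ y) ⬝ᵥ (diagonal r *ᵥ ((Bmat N)ᵀ *ᵥ y)) := by
  have hadj : ∀ x : Fin N → ℝ, y ⬝ᵥ (Bmat N *ᵥ x) = ((Bmat N)ᵀ *ᵥ y) ⬝ᵥ x := fun x => by
    rw [dotProduct_mulVec, mulVec_transpose]
  simp only [← mulVec_mulVec, dotProduct_add, dotProduct_neg, hadj]
  rw [dotProduct_comm (diagonal a *ᵥ Δ)]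
  ring

/-- for the symmetric (h_p = 0) string, the effect of the disturbance on the
Hamiltonian scales at most quadratically in N: H(t) ≤ H(0) + (2N²/r̲)·‖d‖₂². -/
theorem stmt_19 (N : ℕ) (hN : 1 ≤ N) (v0 : ℝ)
    (rlow : ℝ) (hrlow : 0 < rlow)
    (r a m : Fin N → ℝ) (hr : ∀ i, rlow ≤ r i) (ha : ∀ i, 0 < a i) (hm : ∀ i, 0 < m i)
    (d : ℝ → Fin N → ℝ) (hdmeas : Measurable d)
    (hdint : MeasureTheory.IntegrableOn (fun s => d s ⬝ᵥ d s) (Set.Ioi (0 : ℝ)))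
    (p Δ : ℝ → Fin N → ℝ)
    (hdyn : ∀ t : ℝ, 0 ≤ t →
      HasDerivAt p
        (-((Bmat N * Matrix.diagonal r * (Bmat N)ᵀ) *ᵥ
            (Matrix.diagonal (fun i => (m i)⁻¹) *ᵥ p t - v0 • (fun _ : Fin N => (1:ℝ))))
          + (Bmat N * Matrix.diagonal a) *ᵥ Δ t + d t) t ∧
      HasDerivAt Δ
        (-((Bmat N)ᵀ *ᵥ (Matrix.diagonal (fun i => (m i)⁻¹) *ᵥ p t - v0 • (fun _ : Fin N => (1:ℝ))))) t)
    (t : ℝ) (ht : 0 ≤ t) :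
    Ham v0 m a (p t) (Δ t) ≤ Ham v0 m a (p 0) (Δ 0) +
      (2 * (N : ℝ) ^ 2 / rlow) * ∫ s in Set.Ioi (0 : ℝ), d s ⬝ᵥ d s := by
  set c : ℝ := 2 * (N : ℝ) ^ 2 / rlow
  have hc : 0 ≤ c := by positivity
  have hderiv : ∀ s, 0 ≤ s → HasDerivAt (fun s => Ham v0 m a (p s) (Δ s)) _ s := fun s hs =>
    hasDerivAt_Ham v0 a hm (hdyn s hs).1 (hdyn s hs).2
  have hle := intervalIntegral.sub_le_integral_of_hasDeriv_right_of_le (φ := fun s => c * (d s ⬝ᵥ d s))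
    ht (fun s hs => (hderiv s hs.1).continuousAt.continuousWithinAt)
    (fun s hs => (hderiv s hs.1.le).hasDerivWithinAt)
    (integrableOn_Icc_iff_integrableOn_Ioc (by finiteness) |>.2
      ((hdint.mono_set Set.Ioc_subset_Ioi_self).const_mul c))
    (fun s _ => by
      rw [power_balance]
      exact dotProduct_sub_dissipation_le hN hrlow hr _ _)
  rw [intervalIntegral.integral_const_mul, intervalIntegral.integral_of_le ht] at hle
  have hmono : ∫ s in Set.Ioc 0 t, d s ⬝ᵥ d s ≤ ∫ s in Set.Ioi (0 : ℝ), d s ⬝ᵥ d s :=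
    setIntegral_mono_set hdint
      (Filter.Eventually.of_forall fun s => Finset.sum_nonneg fun i _ => mul_self_nonneg _)
      Set.Ioc_subset_Ioi_self.eventuallyLE
  linarith [mul_le_mul_of_nonneg_left hmono hc]
end
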